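/- arXiv:2107.03250 — 4 statements merged into one kernel-verified Lean document; each statement's English description precedes it below -/
import Mathlib

section
/- Let (X, μ) be a Borel probability space, Y = {1,…,k} with k ≥ 2, c : X → Y measurable, and let η, η̂ : X → [0,1]^k be measurable functions with ∫_X ‖η(x) − η̂(x)‖₁ dμ(x) ≤ δ_η for some δ_η ≥ 0. Let G be a countable collection of Borel subsets of X and let G' = G ∪ {E ∩ {x : lu(x; c, η̂) > t} : E ∈ G, t ∈ ℚ}. Suppose φ : ℕ × ℝ → [0,1] satisfies: for all m ∈ ℕ and δ > 0, Pr_{S ∼ μ^{⊗m}}[∃A ∈ G' : |μ̂_S(A) − μ(A)| ≥ δ] ≤ φ(m, δ). Then for every α ∈ (0,1) and δ ∈ (0, α): Pr_{S ∼ μ^{⊗m}}[∃E ∈ G with μ(E) ≥ α and |LU(E; μ, c, η) − LU(E; μ̂_S, c, η̂)| > (4δ + δ_η)/(α − δ)] ≤ φ(m, δ). -/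
open MeasureTheory ProbabilityTheory Metric Set
open scoped ENNReal NNReal

noncomputable section

/-- The pointwise label uncertainty `lu(x; c, η) = 1 - [η(x)]_{c(x)} + max_{y ≠ c(x)} [η(x)]_y`. -/
noncomputable def lu {X : Type*} {k : ℕ} (c : X → Fin k) (η : X → Fin k → ℝ) (x : X) : ℝ :=
  1 - η x (c x) + ⨆ i : {i : Fin k // i ≠ c x}, η x i

/-- The label uncertainty `LU(E; μ, c, η) = (1/μ(E)) ∫_E lu(x; c, η) dμ(x)` of a set `E`. -/
noncomputable def LU {X : Type*} [MeasurableSpace X] {k : ℕ} (E : Set X) (μ : Measure X)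
    (c : X → Fin k) (η : X → Fin k → ℝ) : ℝ :=
  (μ E).toReal⁻¹ * ∫ x in E, lu c η x ∂μ

/-- The empirical measure `μ̂_S = (1/m) ∑ᵢ δ_{xᵢ}` of a finite sample `S`. -/
noncomputable def empMeasure {X : Type*} [MeasurableSpace X] {m : ℕ} (S : Fin m → X) :
    Measure X :=
  (m : ℝ≥0∞)⁻¹ • ∑ i, Measure.dirac (S i)
section helpers
open Filter Topology

lemma lu_bounds {X : Type*} {k : ℕ} (hk : 2 ≤ k) (c : X → Fin k) (η : X → Fin k → ℝ)
    (h01 : ∀ x i, η x i ∈ Set.Icc (0:ℝ) 1) (x : X) : 0 ≤ lu c η x ∧ lu c η x ≤ 2 := by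
  have hne : Nontrivial (Fin k) := Fin.nontrivial_iff_two_le.2 hk
  obtain ⟨j, hj⟩ := exists_ne (c x)
  haveI : Nonempty {i : Fin k // i ≠ c x} := ⟨⟨j, hj⟩⟩
  have h1 : (⨆ i : {i : Fin k // i ≠ c x}, η x i) ≤ 1 := ciSup_le fun i => (h01 x i).2
  have h0 : 0 ≤ (⨆ i : {i : Fin k // i ≠ c x}, η x i) :=
    Real.iSup_nonneg fun i => (h01 x i).1
  have := h01 x (c x)
  unfold lu
  constructor <;> linarith [this.1, this.2]

lemma lu_le_add {X : Type*} {k : ℕ} (hk : 2 ≤ k) (c : X → Fin k) (η ζ : X → Fin k → ℝ) (x : X) :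
    lu c η x ≤ lu c ζ x + ∑ i, |η x i - ζ x i| := by
  have hne : Nontrivial (Fin k) := Fin.nontrivial_iff_two_le.2 hk
  obtain ⟨j, hj⟩ := exists_ne (c x)
  haveI : Nonempty {i : Fin k // i ≠ c x} := ⟨⟨j, hj⟩⟩
  have hs : ∑ i, |η x i - ζ x i| = |η x (c x) - ζ x (c x)|
      + ∑ i ∈ Finset.univ.erase (c x), |η x i - ζ x i| :=
    (Finset.add_sum_erase _ _ (Finset.mem_univ _)).symm
  have h1 : (⨆ i : {i : Fin k // i ≠ c x}, η x i) ≤ (⨆ i : {i : Fin k // i ≠ c x}, ζ x i)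
      + ∑ i ∈ Finset.univ.erase (c x), |η x i - ζ x i| := by
    refine ciSup_le fun i => ?_
    have a1 : ζ x i ≤ ⨆ i : {i : Fin k // i ≠ c x}, ζ x i :=
      le_ciSup (f := fun i : {i : Fin k // i ≠ c x} => ζ x i) (Set.finite_range _).bddAbove i
    have a2 : |η x i - ζ x i| ≤ ∑ i ∈ Finset.univ.erase (c x), |η x i - ζ x i| :=
      Finset.single_le_sum (f := fun i => |η x i - ζ x i|) (fun _ _ => abs_nonneg _)
        (Finset.mem_erase.2 ⟨i.2, Finset.mem_univ _⟩)
    linarith [le_abs_self (η x i - ζ x i)]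
  unfold lu
  linarith [neg_abs_le (η x (c x) - ζ x (c x))]

lemma abs_lu_sub {X : Type*} {k : ℕ} (hk : 2 ≤ k) (c : X → Fin k) (η ζ : X → Fin k → ℝ) (x : X) :
    |lu c η x - lu c ζ x| ≤ ∑ i, |η x i - ζ x i| := by
  have h1 := lu_le_add hk c η ζ x
  have h2 := lu_le_add hk c ζ η x
  simp_rw [abs_sub_comm (ζ x _)] at h2
  rw [abs_le]; constructor <;> linarith

lemma measurable_lu {X : Type*} [MeasurableSpace X] {k : ℕ} (c : X → Fin k) (hc : Measurable c)
    (η : X → Fin k → ℝ) (hη : Measurable η) : Measurable (lu c η) := by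
  have hη' : ∀ i, Measurable fun x => η x i := fun i => (measurable_pi_apply i).comp hη
  have h : ∀ j : Fin k, Measurable fun x => lu (fun _ => j) η x := by
    intro j
    unfold lu
    exact ((measurable_const.sub (hη' j))).add (Measurable.iSup fun i => hη' i)
  have h2 : Measurable fun p : X × Fin k => lu (fun _ => p.2) η p.1 :=
    measurable_from_prod_countable_left h
  exact h2.comp (measurable_id.prodMk hc)

lemma meas_le_close {X : Type*} [MeasurableSpace X] (μ ν : Measure X) [IsFiniteMeasure μ]
    [IsFiniteMeasure ν] (f : X → ℝ) (hf : Measurable f) (E : Set X) (hE : MeasurableSet E)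
    (δ : ℝ) (h : ∀ t : ℚ, |(ν (E ∩ {x | (t:ℝ) < f x})).toReal
      - (μ (E ∩ {x | (t:ℝ) < f x})).toReal| ≤ δ) (t : ℝ) :
    |(ν.restrict E).real {x | t ≤ f x} - (μ.restrict E).real {x | t ≤ f x}| ≤ δ := by
  obtain ⟨u, hu, hut, hlim⟩ := Real.exists_seq_rat_strictMono_tendsto t
  have hset : {x | t ≤ f x} = ⋂ n, {x | (u n : ℝ) < f x} := by
    ext x
    simp only [mem_setOf_eq, mem_iInter]
    exact ⟨fun h n => (hut n).trans_le h, fun h => le_of_tendsto' hlim fun n => (h n).le⟩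
  have key : ∀ ρ : Measure X, IsFiniteMeasure ρ →
      Tendsto (fun n => (ρ (E ∩ {x | (u n : ℝ) < f x})).toReal) atTop
        (𝓝 ((ρ.restrict E).real {x | t ≤ f x})) := by
    intro ρ _
    have h1 : Tendsto (fun n => (ρ.restrict E) {x | (u n : ℝ) < f x}) atTop
        (𝓝 ((ρ.restrict E) {x | t ≤ f x})) := by
      rw [hset]
      refine tendsto_measure_iInter_atTop
        (fun n => (measurableSet_lt measurable_const hf).nullMeasurableSet) ?_
        ⟨0, measure_ne_top _ _⟩
      intro a b hab x hx
      have : (u a : ℝ) ≤ u b := by exact_mod_cast hu.monotone hab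
      exact lt_of_le_of_lt this hx
    have h2 := (ENNReal.tendsto_toReal (measure_ne_top (ρ.restrict E) _)).comp h1
    refine h2.congr fun n => ?_
    simp only [Function.comp]
    rw [Measure.restrict_apply (measurableSet_lt measurable_const hf), inter_comm]
  exact le_of_tendsto' ((key ν inferInstance).sub (key μ inferInstance)).abs fun n => h (u n)

lemma integral_close {X : Type*} [MeasurableSpace X] (μ ν : Measure X) [IsFiniteMeasure μ]
    [IsFiniteMeasure ν] (f : X → ℝ) (hf : Measurable f) (hf0 : ∀ x, 0 ≤ f x ∧ f x ≤ 2)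
    (E : Set X) (hE : MeasurableSet E)
    (δ : ℝ) (h : ∀ t : ℚ, |(ν (E ∩ {x | (t:ℝ) < f x})).toReal
      - (μ (E ∩ {x | (t:ℝ) < f x})).toReal| ≤ δ) :
    |∫ x in E, f x ∂ν - ∫ x in E, f x ∂μ| ≤ 2 * δ := by
  have hint : ∀ ρ : Measure X, IsFiniteMeasure ρ → Integrable f ρ := fun ρ _ =>
    Integrable.of_bound hf.aestronglyMeasurable 2 (ae_of_all _ fun x => by
      rw [Real.norm_of_nonneg (hf0 x).1]; exact (hf0 x).2)
  have hlc : ∀ ρ : Measure X, IsFiniteMeasure ρ →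
      ∫ x, f x ∂ρ = ∫ t in Ioc 0 2, ρ.real {a | t ≤ f a} := fun ρ hρ =>
    (hint ρ hρ).integral_eq_integral_Ioc_meas_le (ae_of_all _ fun x => (hf0 x).1)
      (ae_of_all _ fun x => (hf0 x).2)
  have hti : ∀ ρ : Measure X, IsFiniteMeasure ρ →
      IntegrableOn (fun t : ℝ => ρ.real {a | t ≤ f a}) (Ioc 0 2) := by
    intro ρ _
    have hanti : Antitone (fun t : ℝ => ρ.real {a | t ≤ f a}) := fun s t hst =>
      measureReal_mono fun a (ha : t ≤ f a) => hst.trans ha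
    exact (hanti.antitoneOn _).integrableOn_isCompact (isCompact_Icc (a := (0:ℝ)) (b := 2))
      |>.mono_set Ioc_subset_Icc_self
  rw [hlc (ν.restrict E) inferInstance, hlc (μ.restrict E) inferInstance,
    ← integral_sub (hti _ inferInstance) (hti _ inferInstance)]
  have := norm_setIntegral_le_of_norm_le_const (μ := (volume : Measure ℝ)) (s := Ioc (0:ℝ) 2)
    (f := fun t => (ν.restrict E).real {a | t ≤ f a} - (μ.restrict E).real {a | t ≤ f a})
    (C := δ) (by simp) (fun t _ => meas_le_close μ ν f hf E hE δ h t)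
  rw [Real.volume_real_Ioc_of_le (by norm_num)] at this
  rw [Real.norm_eq_abs] at this
  linarith

lemma emp_finite {X : Type*} [MeasurableSpace X] {m : ℕ} (S : Fin m → X) :
    IsFiniteMeasure (empMeasure S) := by
  constructor
  unfold empMeasure
  rcases Nat.eq_zero_or_pos m with rfl | hm
  · simp
  · simp only [Measure.smul_apply, Measure.coe_finsetSum, Finset.sum_apply, measure_univ,
      Finset.sum_const, smul_eq_mul]
    simp [ENNReal.mul_lt_top_iff, hm.ne', ENNReal.inv_lt_top, hm]

lemma arith_bound (p q a b d δ δη α : ℝ) (hp : α ≤ p) (hδ : 0 < δ) (hδα : δ < α)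
    (hpq : |q - p| ≤ δ) (hη : 0 ≤ δη) (hab : |a - b| ≤ δη) (hbd : |d - b| ≤ 2 * δ)
    (hb0 : 0 ≤ b) (hb : b ≤ 2 * p) :
    |p⁻¹ * a - q⁻¹ * d| ≤ (4 * δ + δη) / (α - δ) := by
  have hp0 : 0 < p := by linarith
  have hq : α - δ ≤ q := by linarith [(abs_le.1 hpq).1]
  have hr : 0 < α - δ := by linarith
  have hq0 : 0 < q := by linarith
  have e : p⁻¹ * a - q⁻¹ * d = p⁻¹ * (a - b) + q⁻¹ * ((b / p) * (q - p)) - q⁻¹ * (d - b) := by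
    field_simp; ring
  have hbp : |b / p| ≤ 2 := by
    rw [abs_of_nonneg (by positivity), div_le_iff₀ hp0]; exact hb
  have i1 : |p⁻¹ * (a - b)| ≤ (α - δ)⁻¹ * δη := by
    rw [abs_mul, abs_of_pos (inv_pos.2 hp0)]
    gcongr; linarith
  have i2 : |q⁻¹ * ((b / p) * (q - p))| ≤ (α - δ)⁻¹ * (2 * δ) := by
    rw [abs_mul, abs_of_pos (inv_pos.2 hq0), abs_mul]
    gcongr
  have i3 : |q⁻¹ * (d - b)| ≤ (α - δ)⁻¹ * (2 * δ) := by
    rw [abs_mul, abs_of_pos (inv_pos.2 hq0)]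
    gcongr
  rw [e, div_eq_inv_mul (4 * δ + δη)]
  have := abs_sub (p⁻¹ * (a - b) + q⁻¹ * ((b / p) * (q - p))) (q⁻¹ * (d - b))
  have := abs_add_le (p⁻¹ * (a - b)) (q⁻¹ * ((b / p) * (q - p)))
  linarith

end helpers

/-- Generalization of label uncertainty: if `φ` is a complexity penalty for
`G' = G ∪ {E ∩ {lu > t} : E ∈ G, t ∈ ℚ}` and `∫‖η − η̂‖₁ dμ ≤ δ_η`, then with probability at
least `1 − φ(m, δ)` over an i.i.d. sample `S ∼ μ^{⊗m}`, every `E ∈ G` with `μ(E) ≥ α`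
satisfies `|LU(E; μ, c, η) − LU(E; μ̂_S, c, η̂)| ≤ (4δ + δ_η)/(α − δ)`. -/
theorem stmt_1 {X : Type*} [MeasurableSpace X] (μ : Measure X) [IsProbabilityMeasure μ]
    (k : ℕ) (hk : 2 ≤ k) (c : X → Fin k) (hc : Measurable c)
    (η ηhat : X → Fin k → ℝ) (hη : Measurable η) (hηhat : Measurable ηhat)
    (hη01 : ∀ x i, η x i ∈ Set.Icc (0:ℝ) 1) (hηhat01 : ∀ x i, ηhat x i ∈ Set.Icc (0:ℝ) 1)
    (δη : ℝ) (hδη : 0 ≤ δη)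
    (hL1 : ∫ x, (∑ i, |η x i - ηhat x i|) ∂μ ≤ δη)
    (G : Set (Set X)) (hGc : G.Countable) (hGm : ∀ E ∈ G, MeasurableSet E)
    (G' : Set (Set X))
    (hG' : G' = G ∪ {A | ∃ E ∈ G, ∃ t : ℚ, A = E ∩ {x | (t : ℝ) < lu c ηhat x}})
    (φ : ℕ → ℝ → ℝ) (hφ01 : ∀ m δ, φ m δ ∈ Set.Icc (0:ℝ) 1)
    (hφ : ∀ (m : ℕ) (δ : ℝ), 0 < δ →
      (Measure.pi fun _ : Fin m => μ)
          {S | ∃ A ∈ G', δ ≤ |(empMeasure S A).toReal - (μ A).toReal|}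
        ≤ ENNReal.ofReal (φ m δ))
    (α δ : ℝ) (hα : α ∈ Set.Ioo (0:ℝ) 1) (hδ : δ ∈ Set.Ioo 0 α) (m : ℕ) :
    (Measure.pi fun _ : Fin m => μ)
        {S | ∃ E ∈ G, ENNReal.ofReal α ≤ μ E ∧
          (4*δ + δη)/(α - δ) < |LU E μ c η - LU E (empMeasure S) c ηhat|}
      ≤ ENNReal.ofReal (φ m δ) := by
  refine le_trans (measure_mono ?_) (hφ m δ hδ.1)
  rintro S ⟨E, hEG, hEα, hlt⟩
  by_contra hno
  simp only [mem_setOf_eq, not_exists, not_and, not_le] at hno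
  refine absurd hlt (not_lt.2 ?_)
  haveI := emp_finite S
  have hE := hGm E hEG
  have hint : ∀ ζ : X → Fin k → ℝ, Measurable ζ → (∀ x i, ζ x i ∈ Set.Icc (0:ℝ) 1) →
      Integrable (lu c ζ) (μ.restrict E) := fun ζ hζ h01 =>
    Integrable.of_bound (measurable_lu c hc ζ hζ).aestronglyMeasurable 2 (ae_of_all _ fun x => by
      rw [Real.norm_of_nonneg (lu_bounds hk c ζ h01 x).1]; exact (lu_bounds hk c ζ h01 x).2)
  have hsum : Integrable (fun x => ∑ i, |η x i - ηhat x i|) μ := by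
    refine integrable_finset_sum _ fun i _ => ?_
    refine Integrable.of_bound (C := 1) ?_ (ae_of_all _ fun x => ?_)
    · exact (((measurable_pi_apply i).comp hη).sub
        ((measurable_pi_apply i).comp hηhat)).abs.aestronglyMeasurable
    · rw [Real.norm_eq_abs, abs_abs, abs_le]
      have h1 := hη01 x i
      have h2 := hηhat01 x i
      constructor <;> linarith [h1.1, h1.2, h2.1, h2.2]
  have hnn : ∀ x, 0 ≤ ∑ i, |η x i - ηhat x i| := fun x =>
    Finset.sum_nonneg fun i _ => abs_nonneg _
  unfold LU
  refine arith_bound _ _ _ (∫ x in E, lu c ηhat x ∂μ) _ δ δη α ?_ hδ.1 hδ.2 ?_ hδη ?_ ?_ ?_ ?_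
  · exact (ENNReal.ofReal_le_iff_le_toReal (measure_ne_top _ _)).1 hEα
  · exact (hno E (by rw [hG']; exact Or.inl hEG)).le
  · rw [← integral_sub (hint η hη hη01) (hint ηhat hηhat hηhat01)]
    calc |∫ x in E, (lu c η x - lu c ηhat x) ∂μ|
        ≤ ∫ x in E, |lu c η x - lu c ηhat x| ∂μ := abs_integral_le_integral_abs
      _ ≤ ∫ x in E, ∑ i, |η x i - ηhat x i| ∂μ :=
          integral_mono ((hint η hη hη01).sub (hint ηhat hηhat hηhat01)).abs hsum.integrableOn
            fun x => abs_lu_sub hk c η ηhat x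
      _ ≤ ∫ x, ∑ i, |η x i - ηhat x i| ∂μ :=
          setIntegral_le_integral hsum (ae_of_all _ hnn)
      _ ≤ δη := hL1
  · refine integral_close μ (empMeasure S) (lu c ηhat) (measurable_lu c hc ηhat hηhat)
      (lu_bounds hk c ηhat hηhat01) E hE δ fun t => (hno _ ?_).le
    rw [hG']
    exact Or.inr ⟨E, hEG, t, rfl⟩
  · exact integral_nonneg fun x => (lu_bounds hk c ηhat hηhat01 x).1
  · have := integral_mono (hint ηhat hηhat hηhat01) (integrable_const (2:ℝ))
      fun x => (lu_bounds hk c ηhat hηhat01 x).2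
    refine this.trans (le_of_eq ?_)
    simp [Measure.real, mul_comm]
end
end

section
/- Let (X, Δ) be a metric space with Borel probability measure μ, let Y be a set of labels with at least two elements, and let c : X → Y be a function. For a classifier f : X → Y whose error region E_f = {x ∈ X : f(x) ≠ c(x)} is Borel, define Risk(f, c) = μ(E_f) and AdvRisk_ε(f, c) = μ((E_f)_ε). For α ∈ (0,1) and ε ≥ 0, let F_α be the set of classifiers f : X → Y with Borel error region and Risk(f, c) ≥ α. Then inf_{f ∈ F_α} AdvRisk_ε(f, c) = h(μ, α, ε); equivalently, the intrinsic robustness sup_{f ∈ F_α} (1 − AdvRisk_ε(f, c)) equals 1 − h(μ, α, ε). -/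
open MeasureTheory ProbabilityTheory Metric Set
open scoped ENNReal NNReal

noncomputable section
/-- The infimum of `AdvRisk_ε(f, c) = μ((E_f)_ε)` over classifiers `f` with Borel error region
`E_f = {x : f x ≠ c x}` and `Risk(f, c) = μ(E_f) ≥ α` equals the concentration function
`h(μ, α, ε) = inf {μ(E_ε) : E Borel, μ(E) ≥ α}`; equivalently, the intrinsic robustness
`sup_{f ∈ F_α} (1 − AdvRisk_ε(f, c))` equals `1 − h(μ, α, ε)`. -/
theorem stmt_3 {X : Type*} {Y : Type*} [PseudoMetricSpace X] [MeasurableSpace X]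
    (μ : Measure X) [IsProbabilityMeasure μ]
    (hY : ∃ y₁ y₂ : Y, y₁ ≠ y₂) (c : X → Y)
    (α : ℝ) (hα : α ∈ Set.Ioo (0:ℝ) 1) (ε : ℝ) (hε : 0 ≤ ε) :
    sInf {r : ℝ | ∃ f : X → Y, MeasurableSet {x | f x ≠ c x} ∧
          α ≤ (μ {x | f x ≠ c x}).toReal ∧
          r = (μ (cthickening ε {x | f x ≠ c x})).toReal}
        = sInf {r : ℝ | ∃ E : Set X, MeasurableSet E ∧ α ≤ (μ E).toReal ∧
          r = (μ (cthickening ε E)).toReal} ∧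
    sSup {r : ℝ | ∃ f : X → Y, MeasurableSet {x | f x ≠ c x} ∧
          α ≤ (μ {x | f x ≠ c x}).toReal ∧
          r = 1 - (μ (cthickening ε {x | f x ≠ c x})).toReal}
        = 1 - sInf {r : ℝ | ∃ E : Set X, MeasurableSet E ∧ α ≤ (μ E).toReal ∧
          r = (μ (cthickening ε E)).toReal} := by
  classical
  have key : ∀ E : Set X, ∃ f : X → Y, {x | f x ≠ c x} = E := by
    intro E
    have hne : ∀ y : Y, ∃ z : Y, z ≠ y := by
      intro y
      obtain ⟨y₁, y₂, h⟩ := hY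
      by_cases h1 : y₁ = y
      · exact ⟨y₂, fun h2 => h (h1.trans h2.symm)⟩
      · exact ⟨y₁, h1⟩
    choose g hg using hne
    refine ⟨fun x => if x ∈ E then g (c x) else c x, ?_⟩
    ext x
    by_cases hx : x ∈ E
    · simp [hx, hg]
    · simp [hx]
  refine ⟨?_, ?_⟩
  · congr 1
    ext r
    constructor
    · rintro ⟨f, h1, h2, h3⟩
      exact ⟨_, h1, h2, h3⟩
    · rintro ⟨E, h1, h2, h3⟩
      obtain ⟨f, rfl⟩ := key E
      exact ⟨f, h1, h2, h3⟩
  · set S : Set ℝ := {r : ℝ | ∃ E : Set X, MeasurableSet E ∧ α ≤ (μ E).toReal ∧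
          r = (μ (cthickening ε E)).toReal} with hS
    have hbdd : BddBelow S := by
      refine ⟨0, ?_⟩
      rintro r ⟨E, -, -, rfl⟩
      exact ENNReal.toReal_nonneg
    have hSne : S.Nonempty :=
      ⟨_, Set.univ, MeasurableSet.univ, by simpa using hα.2.le, rfl⟩
    refine IsLUB.csSup_eq ⟨?_, ?_⟩ ?_
    · rintro r ⟨f, h1, h2, rfl⟩
      have := csInf_le hbdd (show _ ∈ S from ⟨_, h1, h2, rfl⟩)
      linarith
    · intro b hb
      have : 1 - b ≤ sInf S := by
        refine le_csInf hSne ?_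
        rintro r ⟨E, h1, h2, rfl⟩
        obtain ⟨f, rfl⟩ := key E
        have := hb ⟨f, h1, h2, rfl⟩
        linarith
      linarith
    · obtain ⟨r, E, h1, h2, h3⟩ := hSne
      obtain ⟨f, rfl⟩ := key E
      exact ⟨_, f, h1, h2, rfl⟩
end
end

section
/- Let (X, Δ) be a metric space, let μ and ν be Borel probability measures on X, let Y = {1,…,k} with k ≥ 2, c : X → Y measurable, η, η̂ : X → [0,1]^k measurable, and let G be a collection of Borel subsets of X. Fix ε ≥ 0, γ ∈ ℝ, α ∈ (0,1), δ ∈ (0, α), and δ' ≥ 0. Assume: (i) for every E ∈ G, |μ(E) − ν(E)| ≤ δ and |μ(E_ε) − ν(E_ε)| ≤ δ; and (ii) for every E ∈ G with μ(E) ≥ α − δ, |LU(E; μ, c, η) − LU(E; ν, c, η̂)| ≤ δ'. Then h(μ, c, η, α − δ, γ − δ', ε, G) − δ ≤ h(ν, c, η̂, α, γ, ε, G) ≤ h(μ, c, η, α + δ, γ + δ', ε, G) + δ. -/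
open MeasureTheory ProbabilityTheory Metric Set
open scoped ENNReal NNReal

noncomputable section

/-- The label-uncertainty-constrained concentration function
`h(μ, c, η, α, γ, ε, G) = inf {μ(E_ε) : E ∈ G, μ(E) ≥ α, LU(E; μ, c, η) ≥ γ}`,
with the convention that the infimum of the empty set is `1` (encoded by adjoining `1`;
for probability measures all candidate values lie in `[0,1]`, so this does not change
the infimum of a nonempty candidate set). -/
noncomputable def hConc {X : Type*} [PseudoMetricSpace X] [MeasurableSpace X] {k : ℕ}
    (μ : Measure X) (c : X → Fin k) (η : X → Fin k → ℝ) (α γ ε : ℝ)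
    (G : Set (Set X)) : ℝ :=
  sInf ({1} ∪ {r : ℝ | ∃ E ∈ G, α ≤ (μ E).toReal ∧ γ ≤ LU E μ c η ∧
    r = (μ (cthickening ε E)).toReal})
/-- Deterministic sandwich bound for the label-uncertainty-constrained concentration function:
if on every `E ∈ G` the measures `μ` and `ν` differ by at most `δ` (both on `E` and on its
`ε`-expansion), and the label uncertainties differ by at most `δ'` whenever `μ(E) ≥ α − δ`,
then `h(μ, c, η, α − δ, γ − δ', ε, G) − δ ≤ h(ν, c, η̂, α, γ, ε, G)
  ≤ h(μ, c, η, α + δ, γ + δ', ε, G) + δ`. -/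
theorem stmt_6 {X : Type*} [PseudoMetricSpace X] [MeasurableSpace X]
    (μ ν : Measure X) [IsProbabilityMeasure μ] [IsProbabilityMeasure ν]
    (k : ℕ) (hk : 2 ≤ k) (c : X → Fin k) (hc : Measurable c)
    (η ηhat : X → Fin k → ℝ) (hη : Measurable η) (hηhat : Measurable ηhat)
    (G : Set (Set X)) (hGm : ∀ E ∈ G, MeasurableSet E)
    (ε : ℝ) (hε : 0 ≤ ε) (γ : ℝ) (α δ δ' : ℝ)
    (hα : α ∈ Set.Ioo (0:ℝ) 1) (hδ : δ ∈ Set.Ioo 0 α) (hδ' : 0 ≤ δ')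
    (h1 : ∀ E ∈ G, |(μ E).toReal - (ν E).toReal| ≤ δ ∧
      |(μ (cthickening ε E)).toReal - (ν (cthickening ε E)).toReal| ≤ δ)
    (h2 : ∀ E ∈ G, α - δ ≤ (μ E).toReal → |LU E μ c η - LU E ν c ηhat| ≤ δ') :
    hConc μ c η (α - δ) (γ - δ') ε G - δ ≤ hConc ν c ηhat α γ ε G ∧
    hConc ν c ηhat α γ ε G ≤ hConc μ c η (α + δ) (γ + δ') ε G + δ := by
  have bdd : ∀ (m : Measure X) (e : X → Fin k → ℝ) (a g : ℝ), BddBelow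
      ({1} ∪ {r : ℝ | ∃ E ∈ G, a ≤ (m E).toReal ∧ g ≤ LU E m c e ∧
        r = (m (cthickening ε E)).toReal}) := by
    intro m e a g
    refine ⟨0, ?_⟩
    rintro r (hr | ⟨E, _, _, _, rfl⟩)
    · rw [Set.mem_singleton_iff.mp hr]; exact zero_le_one
    · exact ENNReal.toReal_nonneg
  have hδ0 := hδ.1
  constructor
  · unfold hConc
    refine le_csInf ⟨1, Or.inl rfl⟩ ?_
    rintro r (hr | ⟨E, hE, ha, hg, rfl⟩)
    · rw [Set.mem_singleton_iff.mp hr]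
      have := csInf_le (bdd μ η (α - δ) (γ - δ')) (Or.inl rfl)
      linarith
    · obtain ⟨h3, h4⟩ := h1 E hE
      rw [abs_le] at h3 h4
      have h5 : α - δ ≤ (μ E).toReal := by linarith
      have h6 := abs_le.mp (h2 E hE h5)
      have := csInf_le (bdd μ η (α - δ) (γ - δ'))
        (Or.inr ⟨E, hE, h5, by linarith, rfl⟩)
      linarith
  · rw [← sub_le_iff_le_add]
    unfold hConc
    refine le_csInf ⟨1, Or.inl rfl⟩ ?_
    rintro r (hr | ⟨E, hE, ha, hg, rfl⟩)
    · rw [Set.mem_singleton_iff.mp hr]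
      have := csInf_le (bdd ν ηhat α γ) (Or.inl rfl)
      linarith
    · obtain ⟨h3, h4⟩ := h1 E hE
      rw [abs_le] at h3 h4
      have h5 : α ≤ (ν E).toReal := by linarith
      have h6 := abs_le.mp (h2 E hE (by linarith))
      have := csInf_le (bdd ν ηhat α γ)
        (Or.inr ⟨E, hE, h5, by linarith, rfl⟩)
      linarith
end
end

section
/- Fix ε ≥ 0 and α ∈ (0,1), and let I = (max(0, 2α − 1), min(2α, 1)). Define g : I → ℝ by g(u) = Φ(Φ⁻¹(u) + ε) + Φ(Φ⁻¹(2α − u) + ε). Then g is differentiable on I and for every u ∈ I: g'(u) = exp(−ε²/2) · (exp(−ε·Φ⁻¹(u)) − exp(−ε·Φ⁻¹(2α − u))). -/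
open MeasureTheory ProbabilityTheory Metric Set
open scoped ENNReal NNReal

noncomputable section

/-- The cumulative distribution function of the standard normal distribution. -/
noncomputable def Phi (t : ℝ) : ℝ := ∫ s in Set.Iic t, Real.exp (-s^2/2) / Real.sqrt (2*Real.pi)

/-- The inverse of `Phi` on `(0,1)`. -/
noncomputable def PhiInv : ℝ → ℝ := Function.invFun Phi

/-- The standard normal density. -/
def phiDens (s : ℝ) : ℝ := Real.exp (-s^2/2) / Real.sqrt (2*Real.pi)

lemma phiDens_eq (s : ℝ) : phiDens s = gaussianPDFReal 0 1 s := by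
  simp [phiDens, gaussianPDFReal, div_eq_inv_mul]

lemma phiDens_pos (s : ℝ) : 0 < phiDens s := by
  unfold phiDens; positivity

lemma phiDens_cont : Continuous phiDens := by
  unfold phiDens; fun_prop

lemma phiDens_int : Integrable phiDens := by
  rw [funext phiDens_eq]; exact integrable_gaussianPDFReal 0 1

lemma Phi_hasDerivAt (t : ℝ) : HasDerivAt Phi (phiDens t) t := by
  have h1 : Phi = fun t => Phi 0 + ∫ s in (0:ℝ)..t, phiDens s := by
    funext t
    have := intervalIntegral.integral_Iic_sub_Iic (μ := volume) (f := phiDens) (a := 0) (b := t)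
      phiDens_int.integrableOn phiDens_int.integrableOn
    rw [← this]
    simp only [Phi, phiDens]; ring
  rw [h1]
  exact (phiDens_cont.integral_hasStrictDerivAt 0 t).hasDerivAt.const_add _

lemma Phi_hasStrictDerivAt (t : ℝ) : HasStrictDerivAt Phi (phiDens t) t :=
  hasStrictDerivAt_of_hasDerivAt_of_continuousAt
    (Filter.Eventually.of_forall Phi_hasDerivAt) phiDens_cont.continuousAt

lemma Phi_strictMono : StrictMono Phi :=
  strictMono_of_deriv_pos fun t => by
    rw [(Phi_hasDerivAt t).deriv]; exact phiDens_pos t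

lemma Phi_eq_cdf : Phi = cdf (gaussianReal 0 1) := by
  funext t
  rw [cdf_eq_real, measureReal_def, gaussianReal_apply_eq_integral 0 one_ne_zero,
    ENNReal.toReal_ofReal]
  · simp only [← phiDens_eq]; rfl
  · exact integral_nonneg fun s => gaussianPDFReal_nonneg 0 1 s

lemma Phi_PhiInv (u : ℝ) (h0 : 0 < u) (h1 : u < 1) : Phi (PhiInv u) = u := by
  apply Function.invFun_eq
  have ha := tendsto_cdf_atBot (gaussianReal 0 1)
  have hb := tendsto_cdf_atTop (gaussianReal 0 1)
  rw [← Phi_eq_cdf] at ha hb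
  obtain ⟨a, ha⟩ := (ha.eventually_le_const h0).exists
  obtain ⟨b, hb⟩ := (hb.eventually_const_le h1).exists
  exact mem_range_of_exists_le_of_exists_ge
    (continuous_iff_continuousAt.2 fun t => (Phi_hasDerivAt t).continuousAt) ⟨a, ha⟩ ⟨b, hb⟩

lemma PhiInv_hasDerivAt (u : ℝ) (h0 : 0 < u) (h1 : u < 1) :
    HasDerivAt PhiInv (phiDens (PhiInv u))⁻¹ u := by
  have h := (Phi_hasStrictDerivAt (PhiInv u)).to_local_left_inverse (phiDens_pos _).ne'
    (g := PhiInv)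
    (Filter.Eventually.of_forall fun x => Function.leftInverse_invFun Phi_strictMono.injective x)
  rw [Phi_PhiInv u h0 h1] at h
  exact h.hasDerivAt

lemma phiDens_ratio (x ε : ℝ) :
    phiDens (x + ε) * (phiDens x)⁻¹ = Real.exp (-ε^2/2) * Real.exp (-ε * x) := by
  rw [← div_eq_mul_inv, div_eq_iff (phiDens_pos x).ne']
  unfold phiDens
  rw [← mul_div_assoc, ← Real.exp_add, ← Real.exp_add]
  congr 2; ring

lemma shift_hasDerivAt (ε u : ℝ) (h0 : 0 < u) (h1 : u < 1) :
    HasDerivAt (fun u => Phi (PhiInv u + ε))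
      (Real.exp (-ε^2/2) * Real.exp (-ε * PhiInv u)) u := by
  rw [← phiDens_ratio]
  exact (Phi_hasDerivAt (PhiInv u + ε)).comp u ((PhiInv_hasDerivAt u h0 h1).add_const ε)

/-- The function `g(u) = Φ(Φ⁻¹(u) + ε) + Φ(Φ⁻¹(2α − u) + ε)` is differentiable on
`I = (max(0, 2α − 1), min(2α, 1))` with derivative
`g'(u) = exp(−ε²/2) · (exp(−ε·Φ⁻¹(u)) − exp(−ε·Φ⁻¹(2α − u)))`. -/
theorem stmt_10 (ε : ℝ) (hε : 0 ≤ ε) (α : ℝ) (hα : α ∈ Set.Ioo (0:ℝ) 1)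
    (I : Set ℝ) (hI : I = Set.Ioo (max 0 (2*α - 1)) (min (2*α) 1))
    (g : ℝ → ℝ)
    (hg : ∀ u ∈ I, g u = Phi (PhiInv u + ε) + Phi (PhiInv (2*α - u) + ε)) :
    ∀ u ∈ I, HasDerivAt g
      (Real.exp (-ε^2/2) *
        (Real.exp (-ε * PhiInv u) - Real.exp (-ε * PhiInv (2*α - u)))) u := by
  intro u hu
  have hnhds : I ∈ nhds u := by
    subst hI; exact isOpen_Ioo.mem_nhds hu
  have hu' := hu
  rw [hI, mem_Ioo, max_lt_iff, lt_min_iff] at hu'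
  obtain ⟨⟨a1, a2⟩, a3, a4⟩ := hu'
  have d1 := shift_hasDerivAt ε u a1 a4
  have d2 : HasDerivAt (fun u => Phi (PhiInv (2*α - u) + ε)) _ u :=
    HasDerivAt.comp u (shift_hasDerivAt ε (2*α - u) (by linarith) (by linarith))
      ((hasDerivAt_id u).const_sub (2*α))
  refine ((d1.add d2).congr_of_eventuallyEq ?_).congr_deriv (by ring)
  filter_upwards [hnhds] with v hv
  exact hg v hv
end
end
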